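/- arXiv:math/0701841 — 8 statements merged into one kernel-verified Lean document; each statement's English description precedes it below -/
import Mathlib

section
/- For every natural number k: if 1 ≤ k ≤ 8 then (1 + 1/(3k))^(2k+1) > 2, and if k ≥ 9 then (1 + 1/(3k))^(2k+1) < 2; if 9 ≤ k ≤ 16 then (1 + 1/(3k−1))^(2k+1) > 2, and if k ≥ 17 then (1 + 1/(3k−1))^(2k+1) < 2; if 17 ≤ k ≤ 25 then (1 + 1/(3k−2))^(2k+1) > 2, and if k ≥ 26 then (1 + 1/(3k−2))^(2k+1) < 2. -/
/-- If `2 * m + 3 ≤ 3 * n`, then raising `m` by `3` and the exponent `n` by `2` does not increase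
`(1 + 1 / m) ^ n`. -/
theorem one_add_one_div_pow_step {m : ℝ} (hm : 0 < m) (n : ℕ) (h : 2 * m + 3 ≤ 3 * n) :
    (1 + 1 / (m + 3)) ^ (n + 2) ≤ (1 + 1 / m) ^ n := by
  have bernoulli : 1 + n * (3 / (m * (m + 4))) ≤ (1 + 3 / (m * (m + 4))) ^ n :=
    one_add_mul_le_pow (by linarith [show 0 < 3 / (m * (m + 4)) by positivity]) n
  have sq_le : (1 + 1 / (m + 3)) ^ 2 ≤ 1 + n * (3 / (m * (m + 4))) := by
    have : (2 * m + 7) / (m + 3) ^ 2 ≤ (2 * m + 3) / (m * (m + 4)) := by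
      rw [div_le_div_iff₀ (by positivity) (by positivity)]
      nlinarith
    calc (1 + 1 / (m + 3)) ^ 2 = 1 + (2 * m + 7) / (m + 3) ^ 2 := by field_simp; ring
      _ ≤ 1 + (2 * m + 3) / (m * (m + 4)) := by gcongr
      _ ≤ 1 + 3 * n / (m * (m + 4)) := by gcongr
      _ = 1 + n * (3 / (m * (m + 4))) := by ring
  calc (1 + 1 / (m + 3)) ^ (n + 2) = (1 + 1 / (m + 3)) ^ n * (1 + 1 / (m + 3)) ^ 2 := pow_add ..
    _ ≤ (1 + 1 / (m + 3)) ^ n * (1 + 3 / (m * (m + 4))) ^ n := by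
      gcongr
      exact sq_le.trans bernoulli
    _ = (1 + 1 / m) ^ n := by
      rw [← mul_pow]
      congr 1
      field_simp
      ring

/-- For `0 ≤ j`, an upper bound for `(1 + 1 / (3 * k - j)) ^ (2 * k + 1)` at `k = a` persists for
all `k ≥ a`. -/
theorem one_add_one_div_pow_lt_of_le {j c : ℝ} (hj : 0 ≤ j) {a k : ℕ} (ha : j < 3 * a)
    (hbase : (1 + 1 / (3 * (a : ℝ) - j)) ^ (2 * a + 1) < c) (hk : a ≤ k) :
    (1 + 1 / (3 * (k : ℝ) - j)) ^ (2 * k + 1) < c := by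
  induction k, hk using Nat.le_induction with
  | base => exact hbase
  | succ k hk ih =>
    have hak : (a : ℝ) ≤ k := by exact_mod_cast hk
    have step := one_add_one_div_pow_step (m := 3 * (k : ℝ) - j) (by linarith) (2 * k + 1)
      (by push_cast; linarith)
    have hm : 3 * ((k + 1 : ℕ) : ℝ) - j = 3 * (k : ℝ) - j + 3 := by push_cast; ring
    rw [hm, show 2 * (k + 1) + 1 = 2 * k + 1 + 2 by ring]
    exact step.trans_lt ih


/-- For the three functions Ш[1](k) = (1+1/(3k))^(2k+1), Ш[2](k) = (1+1/(3k−1))^(2k+1),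
Ш[3](k) = (1+1/(3k−2))^(2k+1) evaluated at positive integers `k`:
Ш[1] > 2 for 1 ≤ k ≤ 8 and Ш[1] < 2 for k ≥ 9; Ш[2] > 2 for 9 ≤ k ≤ 16 and Ш[2] < 2
for k ≥ 17; Ш[3] > 2 for 17 ≤ k ≤ 25 and Ш[3] < 2 for k ≥ 26. -/
theorem stmt_1 (k : ℕ) :
    (1 ≤ k → k ≤ 8 → 2 < (1 + 1 / (3 * (k : ℝ))) ^ (2 * k + 1)) ∧
    (9 ≤ k → (1 + 1 / (3 * (k : ℝ))) ^ (2 * k + 1) < 2) ∧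
    (9 ≤ k → k ≤ 16 → 2 < (1 + 1 / (3 * (k : ℝ) - 1)) ^ (2 * k + 1)) ∧
    (17 ≤ k → (1 + 1 / (3 * (k : ℝ) - 1)) ^ (2 * k + 1) < 2) ∧
    (17 ≤ k → k ≤ 25 → 2 < (1 + 1 / (3 * (k : ℝ) - 2)) ^ (2 * k + 1)) ∧
    (26 ≤ k → (1 + 1 / (3 * (k : ℝ) - 2)) ^ (2 * k + 1) < 2) := by
  refine ⟨fun _ _ => ?_, fun h => ?_, fun _ _ => ?_, fun h => ?_, fun _ _ => ?_, fun h => ?_⟩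
  · interval_cases k <;> norm_num
  · simpa using one_add_one_div_pow_lt_of_le (j := 0) (c := 2) le_rfl (by norm_num) (by norm_num) h
  · interval_cases k <;> norm_num
  · exact one_add_one_div_pow_lt_of_le (by norm_num) (by norm_num) (by norm_num) h
  · interval_cases k <;> norm_num
  · exact one_add_one_div_pow_lt_of_le (by norm_num) (by norm_num) (by norm_num) h
end

section
/- Let m ≥ 0 be a real number and define Ш(x) = (1 + 1/(3x − m))^(2x+1) for real x with x > m/3. Then for every x > m/3 the derivative of Ш at x equals Ш(x)·[2·log(1 + 1/(3x − m)) − 3(2x+1)/((3x − m)(3x − m + 1))], this derivative is strictly negative, and consequently Ш is strictly decreasing on (m/3, ∞). -/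
/-- For `m ≥ 0` and `Ш(x) = (1 + 1/(3x − m))^(2x+1)` (real power) on `x > m/3`:
the derivative of `Ш` at `x` equals
`Ш(x)·[2·log(1 + 1/(3x − m)) − 3(2x+1)/((3x − m)(3x − m + 1))]`, it is strictly
negative, and `Ш` is strictly decreasing on `(m/3, ∞)`. -/
theorem stmt_4 (m : ℝ) (hm : 0 ≤ m) :
    (∀ x : ℝ, m / 3 < x →
      deriv (fun y : ℝ => (1 + 1 / (3 * y - m)) ^ (2 * y + 1)) x
        = (1 + 1 / (3 * x - m)) ^ (2 * x + 1) *
            (2 * Real.log (1 + 1 / (3 * x - m))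
              - 3 * (2 * x + 1) / ((3 * x - m) * (3 * x - m + 1))) ∧
      deriv (fun y : ℝ => (1 + 1 / (3 * y - m)) ^ (2 * y + 1)) x < 0) ∧
    StrictAntiOn (fun y : ℝ => (1 + 1 / (3 * y - m)) ^ (2 * y + 1))
      (Set.Ioi (m / 3)) := by
  have key : ∀ x : ℝ, m / 3 < x →
      HasDerivAt (fun y : ℝ => (1 + 1 / (3 * y - m)) ^ (2 * y + 1))
        ((1 + 1 / (3 * x - m)) ^ (2 * x + 1) *
          (2 * Real.log (1 + 1 / (3 * x - m))
            - 3 * (2 * x + 1) / ((3 * x - m) * (3 * x - m + 1)))) x := by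
    intro x hx
    have ht : 0 < 3 * x - m := by linarith
    have hb : 0 < 1 + 1 / (3 * x - m) := by positivity
    have hlin : HasDerivAt (fun y : ℝ => 3 * y - m) 3 x := by
      simpa using ((hasDerivAt_id x).const_mul 3).sub_const m
    have hbase : HasDerivAt (fun y : ℝ => 1 + 1 / (3 * y - m)) (-3 / (3 * x - m) ^ 2) x := by
      simpa using (hlin.inv ht.ne').const_add 1
    have hexp : HasDerivAt (fun y : ℝ => 2 * y + 1) 2 x := by
      simpa using ((hasDerivAt_id x).const_mul 2).add_const 1
    refine (hbase.rpow hexp hb).congr_deriv ?_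
    rw [Real.rpow_sub_one hb.ne']
    have ht1 : 3 * x - m + 1 ≠ 0 := by positivity
    have hquot : 1 + 1 / (3 * x - m) = (3 * x - m + 1) / (3 * x - m) := by
      field_simp
    generalize Real.log (1 + 1 / (3 * x - m)) = l
    generalize (1 + 1 / (3 * x - m)) ^ (2 * x + 1) = p
    rw [hquot]
    field_simp
    ring
  have hneg : ∀ x : ℝ, m / 3 < x →
      deriv (fun y : ℝ => (1 + 1 / (3 * y - m)) ^ (2 * y + 1)) x < 0 := by
    intro x hx
    rw [(key x hx).deriv]
    have ht : 0 < 3 * x - m := by linarith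
    have hb : 0 < 1 + 1 / (3 * x - m) := by positivity
    have hlog := Real.log_le_sub_one_of_pos hb
    have hlt : 2 / (3 * x - m) < 3 * (2 * x + 1) / ((3 * x - m) * (3 * x - m + 1)) := by
      rw [div_lt_div_iff₀ ht (by positivity)]
      nlinarith
    have htwo : 2 / (3 * x - m) = 2 * (1 / (3 * x - m)) := by ring
    exact mul_neg_of_pos_of_neg (Real.rpow_pos_of_pos hb _) (by linarith)
  refine ⟨fun x hx => ⟨(key x hx).deriv, hneg x hx⟩, ?_⟩
  refine strictAntiOn_of_deriv_neg (convex_Ioi _)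
    (fun x hx => (key x hx).continuousAt.continuousWithinAt) ?_
  rw [interior_Ioi]
  exact hneg
end

section
/- Let m ≥ 0 be a real number and define Ш(x) = (1 + 1/(3x − m))^(2x+1) for real x with x > m/3. Then for every x > m/3 the second derivative of log Ш at x equals [12·(3xm − m²) + 6·(6x − m) + 9] / ((3x − m)²·(3x − m + 1)²), this quantity is strictly positive, and consequently log Ш is strictly convex on (m/3, ∞), i.e. Ш is logarithmically convex there. -/
theorem log_rpow_one_add_inv_eq (m : ℝ) {y : ℝ} (hy : m / 3 < y) :
    Real.log ((1 + 1 / (3 * y - m)) ^ (2 * y + 1)) =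
      (2 * y + 1) * (Real.log (3 * y - m + 1) - Real.log (3 * y - m)) := by
  have hu : 0 < 3 * y - m := by linarith
  rw [Real.log_rpow (by positivity), ← Real.log_div (by positivity) hu.ne']
  congr 2
  field_simp

theorem hasDerivAt_log_rpow_one_add_inv (m : ℝ) {x : ℝ} (hx : m / 3 < x) :
    HasDerivAt (fun y : ℝ => Real.log ((1 + 1 / (3 * y - m)) ^ (2 * y + 1)))
      (2 * (Real.log (3 * x - m + 1) - Real.log (3 * x - m))
        - 3 * (2 * x + 1) / ((3 * x - m) * (3 * x - m + 1))) x := by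
  have hu : 0 < 3 * x - m := by linarith
  have hv : 0 < 3 * x - m + 1 := by linarith
  have hlin : HasDerivAt (fun y : ℝ => 3 * y - m) 3 x := by
    simpa using ((hasDerivAt_id x).const_mul 3).sub_const m
  have hexp : HasDerivAt (fun y : ℝ => 2 * y + 1) 2 x := by
    simpa using ((hasDerivAt_id x).const_mul 2).add_const 1
  have h := hexp.mul (((hlin.add_const 1).log hv.ne').sub (hlin.log hu.ne'))
  refine (h.congr_of_eventuallyEq ?_).congr_deriv ?_
  · filter_upwards [Ioi_mem_nhds hx] with y hy
    exact log_rpow_one_add_inv_eq m hy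
  · simp only [Pi.sub_apply]
    field_simp
    ring

theorem deriv_deriv_log_rpow_one_add_inv (m : ℝ) {x : ℝ} (hx : m / 3 < x) :
    deriv (deriv fun y : ℝ => Real.log ((1 + 1 / (3 * y - m)) ^ (2 * y + 1))) x
      = (12 * (3 * x * m - m ^ 2) + 6 * (6 * x - m) + 9)
          / ((3 * x - m) ^ 2 * (3 * x - m + 1) ^ 2) := by
  have hu : 0 < 3 * x - m := by linarith
  have hv : 0 < 3 * x - m + 1 := by linarith
  have hlin : HasDerivAt (fun y : ℝ => 3 * y - m) 3 x := by
    simpa using ((hasDerivAt_id x).const_mul 3).sub_const m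
  have hnum : HasDerivAt (fun y : ℝ => 3 * (2 * y + 1)) 6 x :=
    ((((hasDerivAt_id x).const_mul 2).add_const 1).const_mul 3).congr_deriv (by norm_num)
  have h := ((((hlin.add_const 1).log hv.ne').sub (hlin.log hu.ne')).const_mul 2).sub
    (hnum.div (hlin.mul (hlin.add_const 1)) (mul_pos hu hv).ne')
  refine ((h.congr_of_eventuallyEq ?_).congr_deriv ?_).deriv
  · filter_upwards [Ioi_mem_nhds hx] with y hy
    exact (hasDerivAt_log_rpow_one_add_inv m hy).deriv
  · simp only [Pi.mul_apply]
    field_simp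
    ring

theorem second_deriv_log_rpow_one_add_inv_pos {m x : ℝ} (hm : 0 ≤ m) (hx : m / 3 < x) :
    0 < (12 * (3 * x * m - m ^ 2) + 6 * (6 * x - m) + 9)
          / ((3 * x - m) ^ 2 * (3 * x - m + 1) ^ 2) := by
  have hu : 0 < 3 * x - m := by linarith
  refine div_pos ?_ (by positivity)
  nlinarith [mul_nonneg hm hu.le]

/-- For `m ≥ 0` and `Ш(x) = (1 + 1/(3x − m))^(2x+1)` (real power) on `x > m/3`:
the second derivative of `log Ш` at `x` equals
`[12·(3xm − m²) + 6·(6x − m) + 9] / ((3x − m)²·(3x − m + 1)²)`, this quantity is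
strictly positive, and `log Ш` is strictly convex on `(m/3, ∞)`
(i.e. `Ш` is logarithmically convex there). -/
theorem stmt_5 (m : ℝ) (hm : 0 ≤ m) :
    (∀ x : ℝ, m / 3 < x →
      iteratedDeriv 2
          (fun y : ℝ => Real.log ((1 + 1 / (3 * y - m)) ^ (2 * y + 1))) x
        = (12 * (3 * x * m - m ^ 2) + 6 * (6 * x - m) + 9)
            / ((3 * x - m) ^ 2 * (3 * x - m + 1) ^ 2) ∧
      0 < (12 * (3 * x * m - m ^ 2) + 6 * (6 * x - m) + 9)
            / ((3 * x - m) ^ 2 * (3 * x - m + 1) ^ 2)) ∧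
    StrictConvexOn ℝ (Set.Ioi (m / 3))
      (fun y : ℝ => Real.log ((1 + 1 / (3 * y - m)) ^ (2 * y + 1))) := by
  refine ⟨fun x hx => ⟨?_, second_deriv_log_rpow_one_add_inv_pos hm hx⟩, ?_⟩
  · rw [iteratedDeriv_succ, iteratedDeriv_one]
    exact deriv_deriv_log_rpow_one_add_inv m hx
  · refine strictConvexOn_of_deriv2_pos' (convex_Ioi _) (fun x hx =>
      (hasDerivAt_log_rpow_one_add_inv m hx).continuousAt.continuousWithinAt) fun x hx => ?_
    exact (second_deriv_log_rpow_one_add_inv_pos hm hx).trans_eq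
      (deriv_deriv_log_rpow_one_add_inv m hx).symm
end

section
/- Define Ω(x) = ⌈3x − 1/(2^(1/(2x+1)) − 1)⌉ for real x > 0, where ⌈y⌉ denotes the least integer greater than or equal to y, and define the special function Ш(x) = (1 + 1/(3x − Ω(x)))^(2x+1). Then Ш(x) tends to 2 as x → +∞. -/
open Filter

lemma tendsto_mul_two_rpow_one_div_sub_one :
    Tendsto (fun n : ℝ => n * ((2 : ℝ) ^ (1 / n) - 1)) atTop (nhds (Real.log 2)) := by
  simpa [Function.comp_def] using
    (tendsto_rpow_sub_one_log two_pos).comp tendsto_inv_atTop_nhdsGT_zero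

/-- Perturbing `1 / (2 ^ (1 / n) - 1)` downwards by at most `1` does not change its
asymptotic behaviour `n / log 2`. -/
lemma tendsto_mul_one_div_of_near {D : ℝ → ℝ}
    (hlow : ∀ n, 1 / ((2 : ℝ) ^ (1 / n) - 1) - 1 ≤ D n)
    (hup : ∀ n, D n ≤ 1 / ((2 : ℝ) ^ (1 / n) - 1)) :
    Tendsto (fun n => n * (1 / D n)) atTop (nhds (Real.log 2)) := by
  have hlog : Real.log 2 ≠ 0 := (Real.log_pos one_lt_two).ne'
  have hA : Tendsto (fun n : ℝ => 1 / ((2 : ℝ) ^ (1 / n) - 1) / n) atTop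
      (nhds (Real.log 2)⁻¹) := by
    refine (tendsto_mul_two_rpow_one_div_sub_one.inv₀ hlog).congr fun n => ?_
    rw [div_div, mul_comm, inv_eq_one_div]
  have hB : Tendsto (fun n : ℝ => (1 / ((2 : ℝ) ^ (1 / n) - 1) - 1) / n) atTop
      (nhds (Real.log 2)⁻¹) := by
    simpa [sub_div] using hA.sub tendsto_inv_atTop_zero
  have hD : Tendsto (fun n => D n / n) atTop (nhds (Real.log 2)⁻¹) := by
    refine tendsto_of_tendsto_of_tendsto_of_le_of_le' hB hA ?_ ?_
    · filter_upwards [eventually_gt_atTop 0] with n hn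
      exact div_le_div_of_nonneg_right (hlow n) hn.le
    · filter_upwards [eventually_gt_atTop 0] with n hn
      exact div_le_div_of_nonneg_right (hup n) hn.le
  simpa [div_eq_mul_inv] using hD.inv₀ (inv_ne_zero hlog)

/-- With `Ω(x) = ⌈3x − 1/(2^(1/(2x+1)) − 1)⌉` for `x > 0` and the special function
`Ш(x) = (1 + 1/(3x − Ω(x)))^(2x+1)` (real power), `Ш(x)` tends to `2` as `x → +∞`. -/
theorem stmt_7 :
    Tendsto (fun x : ℝ =>
        (1 + 1 / (3 * x - ((⌈3 * x - 1 / ((2 : ℝ) ^ (1 / (2 * x + 1)) - 1)⌉ : ℤ) : ℝ)))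
          ^ (2 * x + 1))
      atTop (nhds 2) := by
  let D : ℝ → ℝ := fun n =>
    3 * ((n - 1) / 2) - (⌈3 * ((n - 1) / 2) - 1 / ((2 : ℝ) ^ (1 / n) - 1)⌉ : ℤ)
  have hD : Tendsto (fun n => n * (1 / D n)) atTop (nhds (Real.log 2)) := by
    refine tendsto_mul_one_div_of_near (fun n => ?_) (fun n => ?_)
    · have := Int.ceil_lt_add_one (3 * ((n - 1) / 2) - 1 / ((2 : ℝ) ^ (1 / n) - 1))
      simp only [D]
      linarith
    · have := Int.le_ceil (3 * ((n - 1) / 2) - 1 / ((2 : ℝ) ^ (1 / n) - 1))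
      simp only [D]
      linarith
  have h := Real.tendsto_one_add_rpow_exp_of_tendsto hD
  rw [Real.exp_log two_pos] at h
  have hn : Tendsto (fun x : ℝ => 2 * x + 1) atTop atTop :=
    tendsto_atTop_add_const_right _ _ (tendsto_id.const_mul_atTop two_pos)
  refine (h.comp hn).congr fun x => ?_
  have hx : (2 * x + 1 - 1) / 2 = x := by ring
  simp only [Function.comp_apply, D, hx]
end

section
/- For all real numbers a ≥ 0 and b ≥ 0, the partial products ∏_{r=1}^{n} [r·(r + a + b) / ((r + a)·(r + b))] converge as n → ∞ to Γ(1 + a)·Γ(1 + b)/Γ(1 + a + b), where Γ is the real Gamma function. -/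
open Filter

/-- Splitting the partial product at `n + 1` into Euler's approximations of the Gamma function. -/
theorem prod_Icc_eq_GammaSeq (a b : ℝ) (ha : 0 ≤ a) (hb : 0 ≤ b) {n : ℕ} (hn : n ≠ 0) :
    ∏ r ∈ Finset.Icc 1 (n + 1),
        ((r : ℝ) * ((r : ℝ) + a + b) / (((r : ℝ) + a) * ((r : ℝ) + b))) =
      Real.GammaSeq (1 + a) n * Real.GammaSeq (1 + b) n /
        (Real.GammaSeq (1 + a + b) n * Real.GammaSeq 1 n) := by
  have hn' : (0 : ℝ) < n := by positivity
  have key : ∏ r ∈ Finset.Icc 1 (n + 1),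
        ((r : ℝ) * ((r : ℝ) + a + b) / (((r : ℝ) + a) * ((r : ℝ) + b))) =
      ((∏ j ∈ Finset.range (n + 1), (1 + (j : ℝ))) *
          ∏ j ∈ Finset.range (n + 1), (1 + a + b + (j : ℝ))) /
        ((∏ j ∈ Finset.range (n + 1), (1 + a + (j : ℝ))) *
          ∏ j ∈ Finset.range (n + 1), (1 + b + (j : ℝ))) := by
    rw [← Finset.prod_mul_distrib, ← Finset.prod_mul_distrib, ← Finset.prod_div_distrib,
      Finset.range_eq_Ico, ← Finset.Ico_add_one_right_eq_Icc,
      ← Finset.prod_Ico_add' _ 0 (n + 1) 1]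
    refine Finset.prod_congr rfl fun j _ => ?_
    push_cast
    ring_nf
  have hpos : ∀ s : ℝ, 0 < s → 0 < ∏ j ∈ Finset.range (n + 1), (s + (j : ℝ)) :=
    fun s hs => Finset.prod_pos fun j _ => by positivity
  have h1 := hpos 1 one_pos
  have hpa := hpos (1 + a) (by positivity)
  have hpb := hpos (1 + b) (by positivity)
  have hpab := hpos (1 + a + b) (by positivity)
  have hfac : (0 : ℝ) < n.factorial := by positivity
  have hxa := Real.rpow_pos_of_pos hn' a
  have hxb := Real.rpow_pos_of_pos hn' b
  rw [key]
  simp only [Real.GammaSeq, Real.rpow_add hn', Real.rpow_one]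
  field_simp

/-- For reals `a, b ≥ 0`, the partial products
`∏_{r=1}^{n} [r·(r + a + b) / ((r + a)·(r + b))]` converge to
`Γ(1 + a)·Γ(1 + b)/Γ(1 + a + b)`. -/
theorem stmt_12 (a b : ℝ) (ha : 0 ≤ a) (hb : 0 ≤ b) :
    Tendsto (fun n : ℕ =>
        ∏ r ∈ Finset.Icc 1 n, ((r : ℝ) * ((r : ℝ) + a + b) / (((r : ℝ) + a) * ((r : ℝ) + b))))
      atTop
      (nhds (Real.Gamma (1 + a) * Real.Gamma (1 + b) / Real.Gamma (1 + a + b))) := by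
  rw [← tendsto_add_atTop_iff_nat 1]
  have hΓ : Real.Gamma (1 + a + b) * Real.Gamma 1 ≠ 0 := by
    rw [Real.Gamma_one, mul_one]
    exact (Real.Gamma_pos_of_pos (by positivity)).ne'
  have h := ((Real.GammaSeq_tendsto_Gamma (1 + a)).mul (Real.GammaSeq_tendsto_Gamma (1 + b))).div
    ((Real.GammaSeq_tendsto_Gamma (1 + a + b)).mul (Real.GammaSeq_tendsto_Gamma 1)) hΓ
  rw [Real.Gamma_one, mul_one] at h
  refine h.congr' ?_
  filter_upwards [eventually_ne_atTop 0] with n hn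
  exact (prod_Icc_eq_GammaSeq a b ha hb hn).symm
end

section
/- For every natural number n, the series ∑_{r=0}^{∞} (−1)^r · [∏_{j=0}^{r} ((log 2)/2 − j)] / ((1 + n + r) · r!) converges and its sum equals Γ(n + 1)·Γ(1 + (log 2)/2) / Γ(n + 1 + (log 2)/2). -/
open Filter Topology Finset in
/-- For `a > 0` the product `∏_{j=1}^{N} (1 - a / j)` tends to `0`. -/
theorem tendsto_prod_one_sub_div_succ {a : ℝ} (ha : 0 < a) (ha1 : a ≤ 1) :
    Tendsto (fun N : ℕ => ∏ j ∈ range N, (1 - a / ((j : ℝ) + 1))) atTop (𝓝 0) := by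
  have hfac : ∀ j : ℕ, 0 ≤ 1 - a / ((j : ℝ) + 1) := fun j => by
    rw [sub_nonneg, div_le_one (by positivity)]
    linarith [(Nat.cast_nonneg j : (0 : ℝ) ≤ j)]
  have hexp : Tendsto (fun N : ℕ => Real.exp (-(a * ∑ j ∈ range N, 1 / ((j : ℝ) + 1))))
      atTop (𝓝 0) :=
    Real.tendsto_exp_neg_atTop_nhds_zero.comp
      (Real.tendsto_sum_range_one_div_nat_succ_atTop.const_mul_atTop ha)
  refine squeeze_zero (fun N => prod_nonneg fun j _ => hfac j) (fun N => ?_) hexp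
  rw [mul_sum, ← sum_neg_distrib, Real.exp_sum]
  refine prod_le_prod (fun j _ => hfac j) fun j _ => ?_
  have := Real.add_one_le_exp (-(a * (1 / ((j : ℝ) + 1))))
  rw [mul_one_div] at this ⊢
  linarith

open Filter Topology Finset in
/-- The Gauss evaluation at `1` of a hypergeometric series, by telescoping and induction on `n`. -/
theorem hasSum_prod_one_sub_div_succ {a : ℝ} (ha : 0 < a) (ha1 : a ≤ 1) (n : ℕ) :
    HasSum (fun r : ℕ => a * (∏ j ∈ range r, (1 - a / ((j : ℝ) + 1))) / (1 + n + r))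
      (Real.Gamma (n + 1) * Real.Gamma (1 + a) / Real.Gamma (n + 1 + a)) := by
  set p : ℕ → ℝ := fun r => ∏ j ∈ range r, (1 - a / ((j : ℝ) + 1)) with hp
  have hp_succ : ∀ r, p (r + 1) = p r * (1 - a / ((r : ℝ) + 1)) := fun r => prod_range_succ _ _
  have hp_lim : Tendsto p atTop (𝓝 0) := tendsto_prod_one_sub_div_succ ha ha1
  have hp_nonneg : ∀ r, 0 ≤ p r := fun r => prod_nonneg fun j _ => by
    rw [sub_nonneg, div_le_one (by positivity)]
    linarith [(Nat.cast_nonneg j : (0 : ℝ) ≤ j)]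
  have hterm : ∀ (m r : ℕ), 0 ≤ a * p r / (1 + m + r) := fun m r => by
    have := hp_nonneg r
    positivity
  change HasSum (fun r : ℕ => a * p r / (1 + n + r)) _
  induction n with
  | zero =>
    rw [hasSum_iff_tendsto_nat_of_nonneg (hterm 0)]
    have hsum : ∀ N : ℕ, ∑ r ∈ range N, a * p r / (1 + (0 : ℕ) + r) = 1 - p N := fun N => by
      induction N with
      | zero => simp [hp]
      | succ N ih =>
        rw [sum_range_succ, ih, hp_succ]
        push_cast
        field_simp
        ring
    have hG : Real.Gamma (1 + a) ≠ 0 := (Real.Gamma_pos_of_pos (by linarith)).ne'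
    simp_rw [hsum]
    simpa [hG] using hp_lim.const_sub 1
  | succ n ih =>
    rw [hasSum_iff_tendsto_nat_of_nonneg (hterm n)] at ih
    rw [hasSum_iff_tendsto_nat_of_nonneg (hterm (n + 1))]
    have hsum : ∀ N : ℕ, ∑ r ∈ range N, a * p r / (1 + (n + 1 : ℕ) + r) =
        ((n + 1) * ∑ r ∈ range N, a * p r / (1 + n + r) - a * (p N * (N / (1 + n + N))))
          / (n + 1 + a) := fun N => by
      induction N with
      | zero => simp
      | succ N ih =>
        rw [sum_range_succ, ih, sum_range_succ, hp_succ]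
        push_cast
        have h1 : (1 + n + N : ℝ) ≠ 0 := by positivity
        have h2 : (1 + (n + 1) + N : ℝ) ≠ 0 := by positivity
        have h3 : (1 + n + (N + 1) : ℝ) ≠ 0 := by positivity
        have h4 : (n + 1 + a : ℝ) ≠ 0 := by positivity
        field_simp
        ring
    have hT : Tendsto (fun N : ℕ => p N * ((N : ℝ) / (1 + n + N))) atTop (𝓝 0) := by
      refine squeeze_zero (fun N => mul_nonneg (hp_nonneg N) (by positivity)) (fun N => ?_) hp_lim
      refine mul_le_of_le_one_right (hp_nonneg N) ?_
      rw [div_le_one (by positivity)]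
      linarith [(Nat.cast_nonneg n : (0 : ℝ) ≤ n)]
    simp_rw [hsum]
    have hlim := ((ih.const_mul ((n : ℝ) + 1)).sub (hT.const_mul a)).div_const ((n : ℝ) + 1 + a)
    convert hlim using 2
    have hn : (n + 1 : ℝ) ≠ 0 := by positivity
    have hna : (n + 1 + a : ℝ) ≠ 0 := by positivity
    have hG : Real.Gamma (n + 1 + a) ≠ 0 := (Real.Gamma_pos_of_pos (by positivity)).ne'
    push_cast
    rw [Real.Gamma_add_one hn, show (n + 1 + 1 + a : ℝ) = n + 1 + a + 1 by ring,
      Real.Gamma_add_one hna]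
    field_simp
    ring

open Finset in
theorem neg_one_pow_mul_prod_range_succ_sub (a : ℝ) (r : ℕ) :
    (-1 : ℝ) ^ r * ∏ j ∈ range (r + 1), (a - (j : ℝ)) =
      a * (∏ j ∈ range r, (1 - a / ((j : ℝ) + 1))) * (r.factorial : ℝ) := by
  induction r with
  | zero => simp
  | succ r ih =>
    rw [prod_range_succ, pow_succ, prod_range_succ (fun j : ℕ => 1 - a / ((j : ℝ) + 1)),
      Nat.factorial_succ]
    push_cast
    have h : (r + 1 : ℝ) ≠ 0 := by positivity
    calc _ = ((-1 : ℝ) ^ r * ∏ j ∈ range (r + 1), (a - (j : ℝ))) * (r + 1 - a) := by ring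
      _ = _ := by
        rw [ih]
        field_simp

/-- For every natural number `n`, the series
`∑_{r=0}^{∞} (−1)^r · [∏_{j=0}^{r} ((log 2)/2 − j)] / ((1 + n + r)·r!)` converges
and its sum equals `Γ(n + 1)·Γ(1 + (log 2)/2) / Γ(n + 1 + (log 2)/2)`. -/
theorem stmt_13 (n : ℕ) :
    HasSum
      (fun r : ℕ =>
        (-1 : ℝ) ^ r * (∏ j ∈ Finset.range (r + 1), (Real.log 2 / 2 - (j : ℝ)))
          / ((1 + (n : ℝ) + (r : ℝ)) * (r.factorial : ℝ)))
      (Real.Gamma ((n : ℝ) + 1) * Real.Gamma (1 + Real.log 2 / 2)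
        / Real.Gamma ((n : ℝ) + 1 + Real.log 2 / 2)) := by
  have h2 : Real.log 2 / 2 ≤ 1 := by linarith [Real.log_two_lt_d9]
  have h0 : 0 < Real.log 2 / 2 := by linarith [Real.log_two_gt_d9]
  convert hasSum_prod_one_sub_div_succ h0 h2 n using 2 with r
  rw [neg_one_pow_mul_prod_range_succ_sub, mul_div_mul_right]
  exact_mod_cast r.factorial_ne_zero
end

section
/- For every natural number m, the function x ↦ (1 + 1/(3x − m))^(2x+1) is completely monotonic on the open interval (m/3, ∞). -/
/-- `f` is completely monotonic on `S ⊆ ℝ`: it has derivatives of all orders at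
every point of `S` and `(−1)^n f^(n)(x) ≥ 0` for all `x ∈ S` and all `n ≥ 0`. -/
def CompletelyMonotonicOn (f : ℝ → ℝ) (S : Set ℝ) : Prop :=
  (∀ n : ℕ, ∀ x ∈ S, DifferentiableAt ℝ (iteratedDeriv n f) x) ∧
  (∀ n : ℕ, ∀ x ∈ S, 0 ≤ (-1 : ℝ) ^ n * iteratedDeriv n f x)

/-- The sign conditions `0 ≤ (-1)^k f^(k)` on `S` for `k ≤ n`, phrased recursively: `f ≥ 0` and
`-f'` satisfies the sign conditions up to order `n - 1`. -/
def AlternatingUpTo (S : Set ℝ) : ℕ → (ℝ → ℝ) → Prop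
  | 0, f => ∀ x ∈ S, 0 ≤ f x
  | n + 1, f => (∀ x ∈ S, 0 ≤ f x) ∧
      ∃ g, AlternatingUpTo S n g ∧ ∀ x ∈ S, HasDerivAt f (-g x) x

namespace AlternatingUpTo

variable {S : Set ℝ} {n : ℕ} {f g : ℝ → ℝ}

theorem nonneg (hf : AlternatingUpTo S n f) : ∀ x ∈ S, 0 ≤ f x := by
  cases n with
  | zero => exact hf
  | succ n => exact hf.1

theorem of_succ (hf : AlternatingUpTo S (n + 1) f) : AlternatingUpTo S n f := by
  induction n generalizing f with
  | zero => exact hf.1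
  | succ n ih =>
    obtain ⟨h0, g, hg, hd⟩ := hf
    exact ⟨h0, g, ih hg, hd⟩

theorem const {c : ℝ} (hc : 0 ≤ c) : AlternatingUpTo S n fun _ => c := by
  induction n generalizing c with
  | zero => exact fun _ _ => hc
  | succ n ih =>
    exact ⟨fun _ _ => hc, fun _ => 0, ih le_rfl, fun x _ => by simpa using hasDerivAt_const x c⟩

theorem add (hf : AlternatingUpTo S n f) (hg : AlternatingUpTo S n g) :
    AlternatingUpTo S n fun x => f x + g x := by
  induction n generalizing f g with
  | zero => exact fun x hx => add_nonneg (hf x hx) (hg x hx)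
  | succ n ih =>
    obtain ⟨hf0, f', hf', hfd⟩ := hf
    obtain ⟨hg0, g', hg', hgd⟩ := hg
    refine ⟨fun x hx => add_nonneg (hf0 x hx) (hg0 x hx), _, ih hf' hg', fun x hx => ?_⟩
    exact ((hfd x hx).add (hgd x hx)).congr_deriv (by ring)

theorem mul (hf : AlternatingUpTo S n f) (hg : AlternatingUpTo S n g) :
    AlternatingUpTo S n fun x => f x * g x := by
  induction n generalizing f g with
  | zero => exact fun x hx => mul_nonneg (hf x hx) (hg x hx)
  | succ n ih =>
    have hfn := hf.of_succ
    have hgn := hg.of_succ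
    obtain ⟨hf0, f', hf', hfd⟩ := hf
    obtain ⟨hg0, g', hg', hgd⟩ := hg
    refine ⟨fun x hx => mul_nonneg (hf0 x hx) (hg0 x hx), _,
      (ih hf' hgn).add (ih hfn hg'), fun x hx => ?_⟩
    exact ((hfd x hx).mul (hgd x hx)).congr_deriv (by ring)

theorem exp (hf : AlternatingUpTo S n f) : AlternatingUpTo S n fun x => Real.exp (f x) := by
  induction n with
  | zero => exact fun x _ => (Real.exp_pos _).le
  | succ n ih =>
    have hfn := hf.of_succ
    obtain ⟨-, f', hf', hfd⟩ := hf
    refine ⟨fun x _ => (Real.exp_pos _).le, _, (ih hfn).mul hf', fun x hx => ?_⟩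
    exact (hfd x hx).exp.congr_deriv (by ring)

theorem congr (hS : IsOpen S) (hf : AlternatingUpTo S n f) (h : Set.EqOn f g S) :
    AlternatingUpTo S n g := by
  cases n with
  | zero => exact fun x hx => h hx ▸ hf x hx
  | succ n =>
    obtain ⟨h0, f', hf', hfd⟩ := hf
    refine ⟨fun x hx => h hx ▸ h0 x hx, f', hf', fun x hx => ?_⟩
    exact (hfd x hx).congr_of_eventuallyEq (h.symm.eventuallyEq_of_mem (hS.mem_nhds hx))

theorem inv_linear {a b : ℝ} (ha : 0 ≤ a) (hS : ∀ x ∈ S, 0 < a * x + b) :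
    AlternatingUpTo S n fun x => (a * x + b)⁻¹ := by
  induction n with
  | zero => exact fun x hx => (inv_pos.2 (hS x hx)).le
  | succ n ih =>
    refine ⟨fun x hx => (inv_pos.2 (hS x hx)).le, _, (const ha).mul (ih.mul ih), fun x hx => ?_⟩
    have hne := (hS x hx).ne'
    have hd : HasDerivAt (fun x => a * x + b) a x := by
      simpa using ((hasDerivAt_id x).const_mul a).add_const b
    exact (hd.inv hne).congr_deriv (by field_simp)

theorem iteratedDeriv_nonneg (hS : IsOpen S) (hf : AlternatingUpTo S n f) {x : ℝ} (hx : x ∈ S) :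
    0 ≤ (-1 : ℝ) ^ n * iteratedDeriv n f x := by
  induction n generalizing f with
  | zero => simpa using hf x hx
  | succ n ih =>
    obtain ⟨-, g, hg, hd⟩ := hf
    have he : deriv f =ᶠ[nhds x] -g :=
      Filter.eventuallyEq_of_mem (hS.mem_nhds hx) fun y hy => (hd y hy).deriv
    rw [iteratedDeriv_succ', he.iteratedDeriv_eq, iteratedDeriv_neg, pow_succ]
    simpa using ih hg

theorem differentiableAt_iteratedDeriv (hS : IsOpen S) (hf : AlternatingUpTo S (n + 1) f)
    {x : ℝ} (hx : x ∈ S) : DifferentiableAt ℝ (iteratedDeriv n f) x := by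
  induction n generalizing f with
  | zero =>
    obtain ⟨-, g, -, hd⟩ := hf
    simpa using (hd x hx).differentiableAt
  | succ n ih =>
    obtain ⟨-, g, hg, hd⟩ := hf
    have he : iteratedDeriv n (deriv f) =ᶠ[nhds x] -iteratedDeriv n g := by
      refine Filter.eventuallyEq_of_mem (hS.mem_nhds hx) fun y hy => ?_
      have hy' : deriv f =ᶠ[nhds y] -g :=
        Filter.eventuallyEq_of_mem (hS.mem_nhds hy) fun z hz => (hd z hz).deriv
      rw [hy'.iteratedDeriv_eq, iteratedDeriv_neg, Pi.neg_apply]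
    rw [iteratedDeriv_succ']
    exact (ih hg).neg.congr_of_eventuallyEq he

end AlternatingUpTo

theorem completelyMonotonicOn_of_alternatingUpTo {S : Set ℝ} {f : ℝ → ℝ} (hS : IsOpen S)
    (hf : ∀ n, AlternatingUpTo S n f) : CompletelyMonotonicOn f S :=
  ⟨fun n _ hx => (hf (n + 1)).differentiableAt_iteratedDeriv hS hx,
    fun n _ hx => (hf n).iteratedDeriv_nonneg hS hx⟩

section LogOneAddInv

variable {S : Set ℝ} {a b : ℝ}

theorem hasDerivAt_log_one_add_inv_linear {x : ℝ} (hx : 0 < a * x + b) :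
    HasDerivAt (fun x => Real.log (1 + (a * x + b)⁻¹))
      (-(a * ((a * x + b)⁻¹ * (a * x + (b + 1))⁻¹))) x := by
  have hd : HasDerivAt (fun x => a * x + b) a x := by
    simpa using ((hasDerivAt_id x).const_mul a).add_const b
  have hpos : 0 < 1 + (a * x + b)⁻¹ := by positivity
  have h1 : a * x + (b + 1) ≠ 0 := by linarith
  have h2 : 1 + (a * x + b)⁻¹ = (a * x + (b + 1)) * (a * x + b)⁻¹ := by
    field_simp
    ring
  refine (((hd.inv hx.ne').const_add 1).log hpos.ne').congr_deriv ?_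
  simp only [Pi.inv_apply]
  rw [h2]
  field_simp

theorem alternatingUpTo_log_one_add_inv_linear (ha : 0 ≤ a) (hS : ∀ x ∈ S, 0 < a * x + b)
    (n : ℕ) : AlternatingUpTo S n fun x => Real.log (1 + (a * x + b)⁻¹) := by
  have h0 : ∀ x ∈ S, 0 ≤ Real.log (1 + (a * x + b)⁻¹) := fun x hx =>
    Real.log_nonneg (by linarith [inv_pos.2 (hS x hx)])
  cases n with
  | zero => exact h0
  | succ n =>
    refine ⟨h0, _, (AlternatingUpTo.const ha).mul ((AlternatingUpTo.inv_linear ha hS).mul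
      (AlternatingUpTo.inv_linear (b := b + 1) ha fun x hx => by linarith [hS x hx])),
      fun x hx => hasDerivAt_log_one_add_inv_linear (hS x hx)⟩

theorem alternatingUpTo_inv_sub_log_one_add_inv_linear (ha : 0 ≤ a)
    (hS : ∀ x ∈ S, 0 < a * x + b) (n : ℕ) :
    AlternatingUpTo S n fun x => (a * x + b)⁻¹ - Real.log (1 + (a * x + b)⁻¹) := by
  have h0 : ∀ x ∈ S, 0 ≤ (a * x + b)⁻¹ - Real.log (1 + (a * x + b)⁻¹) := fun x hx => by
    have hu := inv_pos.2 (hS x hx)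
    linarith [Real.log_le_sub_one_of_pos (show 0 < 1 + (a * x + b)⁻¹ by linarith)]
  cases n with
  | zero => exact h0
  | succ n =>
    have hu : AlternatingUpTo S n fun x => (a * x + b)⁻¹ := .inv_linear ha hS
    have hv : AlternatingUpTo S n fun x => (a * x + (b + 1))⁻¹ :=
      .inv_linear ha fun x hx => by linarith [hS x hx]
    refine ⟨h0, _, (AlternatingUpTo.const ha).mul ((hu.mul hu).mul hv), fun x hx => ?_⟩
    have hx0 := hS x hx
    have h1 : a * x + (b + 1) ≠ 0 := by linarith
    have hd : HasDerivAt (fun x => a * x + b) a x := by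
      simpa using ((hasDerivAt_id x).const_mul a).add_const b
    refine ((hd.inv hx0.ne').sub (hasDerivAt_log_one_add_inv_linear hx0)).congr_deriv ?_
    field_simp
    ring

theorem alternatingUpTo_mul_log_one_add_inv_linear (ha : 0 ≤ a)
    (hS : ∀ x ∈ S, 0 < a * x + b) (n : ℕ) :
    AlternatingUpTo S n fun x => (a * x + (b + 1)) * Real.log (1 + (a * x + b)⁻¹) := by
  have h0 : ∀ x ∈ S, 0 ≤ (a * x + (b + 1)) * Real.log (1 + (a * x + b)⁻¹) := fun x hx =>
    mul_nonneg (by linarith [hS x hx])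
      ((alternatingUpTo_log_one_add_inv_linear ha hS 0).nonneg x hx)
  cases n with
  | zero => exact h0
  | succ n =>
    refine ⟨h0, _, (AlternatingUpTo.const ha).mul
      (alternatingUpTo_inv_sub_log_one_add_inv_linear ha hS n), fun x hx => ?_⟩
    have hx0 := hS x hx
    have h1 : a * x + (b + 1) ≠ 0 := by linarith
    have hd : HasDerivAt (fun x => a * x + (b + 1)) a x := by
      simpa using ((hasDerivAt_id x).const_mul a).add_const (b + 1)
    refine (hd.mul (hasDerivAt_log_one_add_inv_linear hx0)).congr_deriv ?_
    field_simp
    ring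

end LogOneAddInv

/-- For every natural number `m`, the special function
`x ↦ (1 + 1/(3x − m))^(2x+1)` (real power) is completely monotonic on `(m/3, ∞)`. -/
theorem stmt_17 (m : ℕ) :
    CompletelyMonotonicOn
      (fun x : ℝ => (1 + 1 / (3 * x - (m : ℝ))) ^ (2 * x + 1))
      (Set.Ioi ((m : ℝ) / 3)) := by
  refine completelyMonotonicOn_of_alternatingUpTo isOpen_Ioi fun n => ?_
  have hS : ∀ x ∈ Set.Ioi ((m : ℝ) / 3), 0 < 3 * x + -(m : ℝ) := fun x hx => by
    have : (m : ℝ) / 3 < x := hx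
    linarith
  have h3 : (0 : ℝ) ≤ 3 := by norm_num
  refine AlternatingUpTo.congr isOpen_Ioi
    (((AlternatingUpTo.const (show (0 : ℝ) ≤ 2 / 3 by norm_num)).mul
      (alternatingUpTo_mul_log_one_add_inv_linear h3 hS n)).add
      ((AlternatingUpTo.const (show 0 ≤ (2 * (m : ℝ) + 1) / 3 by positivity)).mul
        (alternatingUpTo_log_one_add_inv_linear h3 hS n))).exp fun x hx => ?_
  have hpos : 0 < 1 + (3 * x + -(m : ℝ))⁻¹ := by linarith [inv_pos.2 (hS x hx)]
  simp only [one_div, sub_eq_add_neg]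
  rw [Real.rpow_def_of_pos hpos]
  ring_nf
end

section
/- Let a ≥ 0 be a real number and let μ be a nonnegative (Borel) measure on [0, ∞) such that ∫_{[0,∞)} 1/(1+t) dμ(t) < ∞, and define the Stieltjes transform f(x) = a + ∫_{[0,∞)} 1/(x+t) dμ(t) for x > 0. If f is not identically zero on (0, ∞) (i.e. a > 0 or μ ≠ 0), then f(x) > 0 for all x > 0, f is completely monotonic on (0, ∞), and f is logarithmically completely monotonic on (0, ∞): for every integer k ≥ 1 and every x > 0, (−1)^k · (log f)^(k)(x) ≥ 0. -/
open MeasureTheory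

open Set Filter Topology

/-- Kaluza's theorem: if `a` is a positive log-convex sequence, then the coefficients of positive
index of the reciprocal power series are nonpositive. -/
theorem kaluza_reciprocal_nonpos {a b : ℕ → ℝ} (ha : ∀ n, 0 < a n)
    (hlc : ∀ n, a (n + 1) ^ 2 ≤ a n * a (n + 2)) (hb : 0 ≤ b 0)
    (hab : ∀ n, ∑ i ∈ Finset.range (n + 2), a (n + 1 - i) * b i = 0) (n : ℕ) :
    b (n + 1) ≤ 0 := by
  have hmono : Monotone fun n => a (n + 1) / a n := by
    refine monotone_nat_of_le_succ fun n => ?_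
    rw [div_le_div_iff₀ (ha n) (ha (n + 1))]
    nlinarith [hlc n]
  induction n using Nat.strong_induction_on with
  | _ n ih =>
    have h := hab n
    rw [Finset.sum_range_succ] at h
    simp only [Nat.sub_self] at h
    rcases n with _ | n
    · simp only [zero_add, Finset.sum_range_one, Nat.sub_zero] at h
      have := mul_nonneg (ha 1).le hb
      exact nonpos_of_mul_nonpos_right (by simp only [zero_add]; linarith) (ha 0)
    · have h' := hab n
      set r := a (n + 2) / a (n + 1)
      have key : 0 ≤ ∑ i ∈ Finset.range (n + 2), (a (n + 2 - i) - r * a (n + 1 - i)) * b i := by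
        refine Finset.sum_nonneg fun i hi => ?_
        have hi := Finset.mem_range.1 hi
        rcases i with _ | i
        · have : r * a (n + 1) = a (n + 2) := div_mul_cancel₀ _ (ha _).ne'
          simp [this]
        · refine mul_nonneg_of_nonpos_of_nonpos ?_ (ih i (by omega))
          have hq := hmono (show n - i ≤ n + 1 by omega)
          simp only at hq
          rw [div_le_iff₀ (ha _)] at hq
          rw [show n + 2 - (i + 1) = n - i + 1 by omega, show n + 1 - (i + 1) = n - i by omega]
          exact sub_nonpos.2 hq
      have e : ∑ i ∈ Finset.range (n + 2), (a (n + 2 - i) - r * a (n + 1 - i)) * b i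
          = ∑ i ∈ Finset.range (n + 2), a (n + 2 - i) * b i := by
        simp only [sub_mul, Finset.sum_sub_distrib, mul_assoc, ← Finset.mul_sum, h']
        simp
      rw [e] at key
      exact nonpos_of_mul_nonpos_right
        (by simp only [add_assoc, Nat.reduceAdd] at h ⊢; linarith) (ha 0)

section DerivSequence

variable {D : ℕ → ℝ → ℝ} {s : Set ℝ}

theorem contDiffOn_of_hasDerivAt_seq (hs : IsOpen s)
    (hD : ∀ n, ∀ x ∈ s, HasDerivAt (D n) (-(n + 1) * D (n + 1) x) x) (k n : ℕ) :
    ContDiffOn ℝ k (D n) s := by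
  induction k generalizing n with
  | zero =>
    exact contDiffOn_zero.2 fun x hx => (hD n x hx).continuousAt.continuousWithinAt
  | succ k ih =>
    push_cast
    rw [contDiffOn_succ_iff_deriv_of_isOpen hs]
    refine ⟨fun x hx => (hD n x hx).differentiableAt.differentiableWithinAt, by simp, ?_⟩
    exact (contDiffOn_const.mul (ih (n + 1))).congr fun x hx => (hD n x hx).deriv

theorem iteratedDeriv_of_hasDerivAt_seq (hs : IsOpen s)
    (hD : ∀ n, ∀ x ∈ s, HasDerivAt (D n) (-(n + 1) * D (n + 1) x) x) (n : ℕ) :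
    EqOn (iteratedDeriv n (D 0)) (fun x => (-1) ^ n * n.factorial * D n x) s := by
  induction n with
  | zero => intro x _; simp
  | succ n ih =>
    intro x hx
    rw [iteratedDeriv_succ, (ih.eventuallyEq_of_mem (hs.mem_nhds hx)).deriv_eq,
      ((hD n x hx).const_mul _).deriv, Nat.factorial_succ]
    push_cast
    ring

end DerivSequence

/-- If the Taylor coefficients of `f` at `x`, up to alternating signs, form a positive log-convex
sequence, then the derivatives of `1 / f` at `x` of positive order have alternating signs. -/
theorem iteratedDeriv_inv_sign {f : ℝ → ℝ} {x : ℝ} {a : ℕ → ℝ} (ha : ∀ n, 0 < a n)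
    (hlc : ∀ n, a (n + 1) ^ 2 ≤ a n * a (n + 2)) (hf : ∀ n : ℕ, ContDiffAt ℝ n f x)
    (hfa : ∀ n, iteratedDeriv n f x = (-1) ^ n * n.factorial * a n) (n : ℕ) :
    (-1) ^ (n + 1) * iteratedDeriv (n + 1) f⁻¹ x ≤ 0 := by
  have hx : f x = a 0 := by simpa using hfa 0
  have hx0 : f x ≠ 0 := hx ▸ (ha 0).ne'
  let b : ℕ → ℝ := fun n => (-1) ^ n * iteratedDeriv n f⁻¹ x / n.factorial
  have hb : b (n + 1) ≤ 0 := by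
    refine kaluza_reciprocal_nonpos ha hlc ?_ (fun m => ?_) n
    · simp [b, hx, (ha 0).le]
    · have h1 : f⁻¹ * f =ᶠ[𝓝 x] fun _ => 1 := by
        filter_upwards [(hf 0).continuousAt.eventually_ne hx0] with y hy
        simp [hy]
      have h2 := h1.iteratedDeriv_eq (m + 1)
      rw [iteratedDeriv_const, if_neg (Nat.succ_ne_zero m),
        iteratedDeriv_mul ((hf _).inv hx0) (hf _)] at h2
      have h3 : ∑ i ∈ Finset.range (m + 2), a (m + 1 - i) * b i
          = (-1) ^ (m + 1) / ((m + 1).factorial : ℝ) *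
            ∑ i ∈ Finset.range (m + 1 + 1), ((m + 1).choose i : ℝ) *
              iteratedDeriv i f⁻¹ x * iteratedDeriv (m + 1 - i) f x := by
        rw [Finset.mul_sum]
        refine Finset.sum_congr rfl fun i hi => ?_
        have hi : i ≤ m + 1 := Nat.lt_succ_iff.1 (Finset.mem_range.1 hi)
        obtain ⟨j, hj⟩ := Nat.exists_eq_add_of_le hi
        rw [hj, Nat.add_sub_cancel_left, hfa, Nat.cast_add_choose]
        have := (Nat.factorial_pos i).ne'
        have := (Nat.factorial_pos j).ne'
        have := (Nat.factorial_pos (i + j)).ne'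
        have hs : ((-1 : ℝ) ^ j) ^ 2 = 1 := by rw [← pow_mul, mul_comm, pow_mul]; simp
        simp only [b]
        field_simp
        rw [pow_add]
        linear_combination (-((-1 : ℝ) ^ i * a j * iteratedDeriv i f⁻¹ x)) * hs
      rw [h3, h2, mul_zero]
  have hfac : (0 : ℝ) < (n + 1).factorial := by exact_mod_cast Nat.factorial_pos _
  by_contra! h
  exact absurd hb (not_le.2 (div_pos h hfac))

/-- If `f > 0` has derivatives of alternating signs and the derivatives of positive order of
`1 / f` have the opposite signs, then the derivatives of `log f` alternate in sign. -/
theorem iteratedDeriv_log_sign {f : ℝ → ℝ} {x : ℝ} (hf : ∀ n : ℕ, ContDiffAt ℝ n f x)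
    (hx : 0 < f x) (hsign : ∀ n, 0 ≤ (-1) ^ n * iteratedDeriv n f x)
    (hinv : ∀ n, (-1) ^ (n + 1) * iteratedDeriv (n + 1) f⁻¹ x ≤ 0) (k : ℕ) :
    0 ≤ (-1) ^ (k + 1) * iteratedDeriv (k + 1) (fun y => Real.log (f y)) x := by
  have h1 : deriv (fun y => Real.log (f y)) =ᶠ[𝓝 x] -(f * deriv f⁻¹) := by
    filter_upwards [(hf 0).continuousAt.eventually_ne hx.ne', (hf 1).eventually (by simp)]
      with y hy hy1
    have hd : DifferentiableAt ℝ f y := hy1.differentiableAt (by simp)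
    rw [deriv.log hd hy]
    simp only [Pi.neg_apply, Pi.mul_apply, (hd.hasDerivAt.inv hy).deriv]
    field_simp
  have h2 : ContDiffAt ℝ k (deriv f⁻¹) x :=
    ((hf (k + 1)).inv hx.ne').derivWithin (by simp)
  rw [iteratedDeriv_succ', h1.iteratedDeriv_eq, iteratedDeriv_neg, iteratedDeriv_mul (hf k) h2,
    mul_neg, pow_succ, mul_neg_one, neg_mul, neg_neg, Finset.mul_sum]
  refine Finset.sum_nonneg fun i hi => ?_
  obtain ⟨j, rfl⟩ := Nat.exists_eq_add_of_le (Nat.lt_succ_iff.1 (Finset.mem_range.1 hi))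
  rw [Nat.add_sub_cancel_left, ← iteratedDeriv_succ']
  have h4 : 0 ≤ (-1) ^ j * iteratedDeriv (j + 1) f⁻¹ x := by
    have := hinv j
    rw [pow_succ] at this
    linarith
  have h5 : (0 : ℝ) ≤ (i + j).choose i := Nat.cast_nonneg _
  calc (0 : ℝ) ≤ (i + j).choose i * ((-1) ^ i * iteratedDeriv i f x) *
        ((-1) ^ j * iteratedDeriv (j + 1) f⁻¹ x) := mul_nonneg (mul_nonneg h5 (hsign i)) h4
    _ = _ := by rw [pow_add]; ring

section Stieltjes

variable {μ : Measure ℝ}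

/-- The Taylor coefficients, up to sign, of the Stieltjes transform of `μ`. -/
noncomputable def stieltjesMoment (μ : Measure ℝ) (n : ℕ) (x : ℝ) : ℝ :=
  ∫ t, ((x + t)⁻¹) ^ (n + 1) ∂μ

theorem integrable_inv_add_pow (h0 : ∀ᵐ t ∂μ, 0 ≤ t) (h1 : Integrable (fun t => (1 + t)⁻¹) μ)
    {x : ℝ} (hx : 0 < x) (n : ℕ) : Integrable (fun t => ((x + t)⁻¹) ^ (n + 1)) μ := by
  refine (h1.const_mul (x⁻¹ ^ n * (1 + x⁻¹))).mono'
    (by measurability) ?_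
  filter_upwards [h0] with t ht
  have hxt : 0 < x + t := by linarith
  rw [Real.norm_of_nonneg (by positivity), pow_succ, mul_assoc]
  refine mul_le_mul ?_ ?_ (by positivity) (by positivity)
  · gcongr
    linarith
  · rw [inv_le_iff_one_le_mul₀ hxt, mul_assoc, mul_comm _ (x + t), ← mul_assoc,
      ← div_eq_mul_inv, one_le_div (by linarith)]
    have : x⁻¹ * x = 1 := inv_mul_cancel₀ hx.ne'
    have : 0 ≤ x⁻¹ * t := by positivity
    nlinarith

theorem hasDerivAt_stieltjesMoment (h0 : ∀ᵐ t ∂μ, 0 ≤ t)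
    (h1 : Integrable (fun t => (1 + t)⁻¹) μ) {x : ℝ} (hx : 0 < x) (n : ℕ) :
    HasDerivAt (stieltjesMoment μ n) (-(n + 1) * stieltjesMoment μ (n + 1) x) x := by
  have key := (hasDerivAt_integral_of_dominated_loc_of_deriv_le (μ := μ) (x₀ := x)
    (F := fun x t => ((x + t)⁻¹) ^ (n + 1))
    (F' := fun x t => -(n + 1) * ((x + t)⁻¹) ^ (n + 1 + 1))
    (bound := fun t => (n + 1) * ((x / 2 + t)⁻¹) ^ (n + 1 + 1))
    (Ioi_mem_nhds (half_lt_self hx)) (Eventually.of_forall fun y => by measurability)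
    (integrable_inv_add_pow h0 h1 hx n) (by measurability) ?_
    ((integrable_inv_add_pow h0 h1 (half_pos hx) (n + 1)).const_mul _) ?_).2
  · rwa [integral_const_mul] at key
  · filter_upwards [h0] with t ht y hy
    have hy : x / 2 < y := hy
    have hyt : 0 < y + t := by linarith
    rw [norm_mul, norm_neg, Real.norm_of_nonneg (by positivity),
      Real.norm_of_nonneg (by positivity)]
    gcongr
  · filter_upwards [h0] with t ht y hy
    have hy : x / 2 < y := hy
    have hyt : y + t ≠ 0 := by linarith
    convert! (((hasDerivAt_id y).add_const t).inv hyt).pow (n + 1) using 1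
    rw [Nat.add_sub_cancel, Pi.inv_apply]
    push_cast
    simp only [id, neg_div, one_div, ← inv_pow]
    ring

theorem stieltjesMoment_nonneg (h0 : ∀ᵐ t ∂μ, 0 ≤ t) {x : ℝ} (hx : 0 < x) (n : ℕ) :
    0 ≤ stieltjesMoment μ n x := by
  refine integral_nonneg_of_ae ?_
  filter_upwards [h0] with t ht
  have : 0 < x + t := by linarith
  simp only [Pi.zero_apply]
  positivity

theorem stieltjesMoment_pos (h0 : ∀ᵐ t ∂μ, 0 ≤ t) (h1 : Integrable (fun t => (1 + t)⁻¹) μ)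
    (hμ : μ ≠ 0) {x : ℝ} (hx : 0 < x) (n : ℕ) : 0 < stieltjesMoment μ n x := by
  refine (stieltjesMoment_nonneg h0 hx n).lt_of_ne' fun h => hμ ?_
  rw [stieltjesMoment, integral_eq_zero_iff_of_nonneg_ae ?_ (integrable_inv_add_pow h0 h1 hx n)]
    at h
  · rw [← ae_eq_bot, ← eventually_false_iff_eq_bot]
    filter_upwards [h0, h] with t ht h
    have : 0 < x + t := by linarith
    have : 0 < ((x + t)⁻¹) ^ (n + 1) := by positivity
    exact this.ne' h
  · filter_upwards [h0] with t ht
    have : 0 < x + t := by linarith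
    simp only [Pi.zero_apply]
    positivity

theorem stieltjesMoment_logConvex (h0 : ∀ᵐ t ∂μ, 0 ≤ t)
    (h1 : Integrable (fun t => (1 + t)⁻¹) μ) (hμ : μ ≠ 0) {x : ℝ} (hx : 0 < x) (n : ℕ) :
    stieltjesMoment μ (n + 1) x ^ 2 ≤ stieltjesMoment μ n x * stieltjesMoment μ (n + 2) x := by
  have hi := integrable_inv_add_pow h0 h1 hx
  have hC := stieltjesMoment_pos h0 h1 hμ hx (n + 2)
  set r := stieltjesMoment μ (n + 1) x / stieltjesMoment μ (n + 2) x
  have hq : 0 ≤ ∫ t, (((x + t)⁻¹) ^ (n + 1) - 2 * r * ((x + t)⁻¹) ^ (n + 1 + 1)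
      + r ^ 2 * ((x + t)⁻¹) ^ (n + 2 + 1)) ∂μ := by
    refine integral_nonneg_of_ae ?_
    filter_upwards [h0] with t ht
    have : 0 < x + t := by linarith
    have : 0 ≤ ((x + t)⁻¹) ^ (n + 1) * (1 - r * (x + t)⁻¹) ^ 2 := by positivity
    simp only [Pi.zero_apply]
    convert! this using 1
    ring
  rw [integral_add (f := fun t => ((x + t)⁻¹) ^ (n + 1) - 2 * r * ((x + t)⁻¹) ^ (n + 1 + 1))
      ((hi n).sub ((hi (n + 1)).const_mul _)) ((hi (n + 2)).const_mul _),
    integral_sub (hi n) ((hi (n + 1)).const_mul _), integral_const_mul, integral_const_mul] at hq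
  change 0 ≤ stieltjesMoment μ n x - 2 * r * stieltjesMoment μ (n + 1) x
    + r ^ 2 * stieltjesMoment μ (n + 2) x at hq
  have hB : stieltjesMoment μ (n + 1) x = r * stieltjesMoment μ (n + 2) x :=
    (div_mul_cancel₀ _ hC.ne').symm
  rw [hB] at hq ⊢
  nlinarith [mul_nonneg hq hC.le]

end Stieltjes

/-- Every nonzero Stieltjes transform `f(x) = a + ∫_{[0,∞)} dμ(t)/(x+t)`
(with `a ≥ 0` and `μ` a nonnegative measure on `[0,∞)` with
`∫ 1/(1+t) dμ(t) < ∞`) is strictly positive on `(0, ∞)`, completely monotonic on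
`(0, ∞)`, and logarithmically completely monotonic on `(0, ∞)`:
`(−1)^k (log f)^(k)(x) ≥ 0` for all `k ≥ 1` and `x > 0`. -/
theorem stmt_18 (a : ℝ) (ha : 0 ≤ a) (μ : Measure ℝ)
    (hμsupp : μ (Set.Iio 0) = 0)
    (hμfin : ∫⁻ t, ENNReal.ofReal (1 / (1 + t)) ∂μ < ⊤)
    (f : ℝ → ℝ)
    (hf : ∀ x : ℝ, f x = a + (∫⁻ t, ENNReal.ofReal (1 / (x + t)) ∂μ).toReal)
    (hnz : 0 < a ∨ μ ≠ 0) :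
    (∀ x : ℝ, 0 < x → 0 < f x) ∧
    CompletelyMonotonicOn f (Set.Ioi 0) ∧
    (∀ k : ℕ, 1 ≤ k → ∀ x : ℝ, 0 < x →
      0 ≤ (-1 : ℝ) ^ k * iteratedDeriv k (fun y => Real.log (f y)) x) := by
  have h0 : ∀ᵐ t ∂μ, 0 ≤ t := by
    rw [ae_iff]
    simpa [Iio] using hμsupp
  have h1 : Integrable (fun t : ℝ => (1 + t)⁻¹) μ := by
    refine ⟨by measurability, ?_⟩
    rw [hasFiniteIntegral_iff_ofReal]
    · simpa using hμfin
    · filter_upwards [h0] with t ht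
      simp only [Pi.zero_apply]
      positivity
  let D : ℕ → ℝ → ℝ := fun n x => (if n = 0 then a else 0) + stieltjesMoment μ n x
  have hD : ∀ n, ∀ x ∈ Ioi (0 : ℝ), HasDerivAt (D n) (-(n + 1) * D (n + 1) x) x := by
    intro n x hx
    simpa [D] using (hasDerivAt_stieltjesMoment h0 h1 hx n).const_add (if n = 0 then a else 0)
  have hfD : EqOn f (D 0) (Ioi 0) := by
    intro x hx
    have hx : 0 < x := hx
    simp only [hf, D, stieltjesMoment, if_pos, zero_add, pow_one]
    rw [integral_eq_lintegral_of_nonneg_ae _ (by measurability)]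
    · simp
    · filter_upwards [h0] with t ht
      simp only [Pi.zero_apply]
      positivity
  have hD0 : ∀ n, ∀ x ∈ Ioi (0 : ℝ), 0 ≤ D n x := fun n x hx =>
    add_nonneg (by split_ifs <;> simp [ha]) (stieltjesMoment_nonneg h0 hx n)
  have hiter : ∀ n, EqOn (iteratedDeriv n f) (fun x => (-1) ^ n * n.factorial * D n x) (Ioi 0) :=
    fun n => (hfD.iteratedDeriv_of_isOpen isOpen_Ioi n).trans
      (iteratedDeriv_of_hasDerivAt_seq isOpen_Ioi hD n)
  have hsmooth : ∀ x ∈ Ioi (0 : ℝ), ∀ n : ℕ, ContDiffAt ℝ n f x := fun x hx n =>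
    ((contDiffOn_of_hasDerivAt_seq isOpen_Ioi hD n 0).congr hfD).contDiffAt (Ioi_mem_nhds hx)
  have hpos : ∀ x : ℝ, 0 < x → 0 < f x := by
    intro x hx
    rw [hfD hx]
    simp only [D, if_pos]
    rcases hnz with h | h
    · linarith [stieltjesMoment_nonneg h0 hx 0]
    · linarith [stieltjesMoment_pos h0 h1 h hx 0]
  have hsign : ∀ n, ∀ x ∈ Ioi (0 : ℝ), 0 ≤ (-1) ^ n * iteratedDeriv n f x := by
    intro n x hx
    rw [hiter n hx, ← mul_assoc, ← mul_assoc, ← mul_pow]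
    simpa using mul_nonneg n.factorial.cast_nonneg (hD0 n x hx)
  refine ⟨hpos, ⟨fun n x hx => ?_, hsign⟩, fun k hk x hx => ?_⟩
  · exact ((hD n x hx).differentiableAt.const_mul _).congr_of_eventuallyEq
      ((hiter n).eventuallyEq_of_mem (Ioi_mem_nhds hx))
  · obtain ⟨k, rfl⟩ := Nat.exists_eq_succ_of_ne_zero (Nat.one_le_iff_ne_zero.1 hk)
    refine iteratedDeriv_log_sign (hsmooth x hx) (hpos x hx) (fun n => hsign n x hx)
      (fun n => ?_) k
    rcases eq_or_ne μ 0 with rfl | hμ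
    · have hfa : f⁻¹ = fun _ => a⁻¹ := by
        ext y
        simp [hf]
      simp [hfa, iteratedDeriv_const]
    · refine iteratedDeriv_inv_sign (a := fun n => D n x) (fun n => ?_) (fun n => ?_)
        (hsmooth x hx) (fun n => hiter n hx) n
      · exact add_pos_of_nonneg_of_pos (by split_ifs <;> simp [ha])
          (stieltjesMoment_pos h0 h1 hμ hx n)
      · have hlc := stieltjesMoment_logConvex h0 h1 hμ hx n
        have h2 := stieltjesMoment_nonneg h0 hx (n + 2)
        have h3 : (0 : ℝ) ≤ if n = 0 then a else 0 := by split_ifs <;> simp [ha]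
        simp only [D, Nat.add_eq_zero_iff, one_ne_zero, OfNat.ofNat_ne_zero, and_false, if_false,
          zero_add]
        nlinarith [mul_nonneg h3 h2]
end
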